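/- arXiv:1904.08857 — 2 statements merged into one kernel-verified Lean document; each statement's English description precedes it below -/
import Mathlib

section
/- Let p be a prime. Then in ℤ[q], the polynomial 𝔣_{p-1}(q) is congruent to −1 modulo [p]_q := 1 + q + ⋯ + q^{p−1}, i.e. [p]_q divides 𝔣_{p-1}(q) + 1. -/
open Finset Polynomial

/-- The representative in `{1,…,n}` of a residue class `a : ZMod n`. -/
def zrep (n : ℕ) (a : ZMod n) : ℕ := if a.val = 0 then n else a.val

/-- The major index of a permutation of `{1,…,n}` (identified with `ZMod n`). -/
def maj (n : ℕ) (σ : Equiv.Perm (ZMod n)) : ℕ :=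
  ∑ i ∈ Finset.Icc 1 (n - 1),
    if zrep n (σ ((i : ZMod n) + 1)) < zrep n (σ (i : ZMod n)) then i else 0

/-- The cyclic major index. -/
def majbar (n : ℕ) (σ : Equiv.Perm (ZMod n)) : ℕ :=
  ∑ i ∈ Finset.Icc 1 n,
    if zrep n (σ ((i : ZMod n) + 1)) < zrep n (σ (i : ZMod n)) then i else 0

/-- The cyclic descent number. -/
def desbar (n : ℕ) (σ : Equiv.Perm (ZMod n)) : ℕ :=
  ((Finset.Icc 1 n).filter
    (fun i : ℕ => zrep n (σ (((i : ℕ) : ZMod n) + 1)) < zrep n (σ ((i : ℕ) : ZMod n)))).card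

/-- Conjugation by the rotation `a ↦ a + 1`. -/
def Tmap (n : ℕ) (σ : Equiv.Perm (ZMod n)) : Equiv.Perm (ZMod n) :=
  Equiv.addRight (1 : ZMod n) * σ * (Equiv.addRight (1 : ZMod n))⁻¹

theorem zrep_pos (n : ℕ) [NeZero n] (a : ZMod n) : 0 < zrep n a := by
  have := NeZero.pos n
  unfold zrep
  split_ifs <;> omega

theorem zrep_le (n : ℕ) [NeZero n] (a : ZMod n) : zrep n a ≤ n := by
  have := ZMod.val_lt a
  unfold zrep
  split_ifs <;> omega

theorem natCast_zrep (n : ℕ) [NeZero n] (a : ZMod n) : (zrep n a : ZMod n) = a := by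
  unfold zrep
  split_ifs with h
  · rw [ZMod.natCast_self, ((ZMod.val_eq_zero a).1 h)]
  · exact ZMod.natCast_zmod_val a

/-- The indicator of a cyclic descent of `σ` at `i`. -/
def descent (n : ℕ) (σ : Equiv.Perm (ZMod n)) (i : ZMod n) : ℤ :=
  if zrep n (σ (i + 1)) < zrep n (σ i) then 1 else 0

theorem mul_descent (n : ℕ) [NeZero n] (σ : Equiv.Perm (ZMod n)) (i : ZMod n) :
    (n : ℤ) * descent n σ i =
      (σ (i + 1) - σ i).val - zrep n (σ (i + 1)) + zrep n (σ i) := by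
  unfold descent
  have hx := zrep_pos n (σ i)
  have hx' := zrep_le n (σ i)
  have hy := zrep_pos n (σ (i + 1))
  have hy' := zrep_le n (σ (i + 1))
  have hxc := natCast_zrep n (σ i)
  have hyc := natCast_zrep n (σ (i + 1))
  split_ifs with h
  · have hval : (σ (i + 1) - σ i).val = zrep n (σ (i + 1)) + n - zrep n (σ i) := by
      rw [← ZMod.val_natCast_of_lt (a := zrep n (σ (i + 1)) + n - zrep n (σ i)) (n := n) (by omega),
        Nat.cast_sub (by omega), Nat.cast_add, hxc, hyc, ZMod.natCast_self, add_zero]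
    rw [hval]
    omega
  · have hval : (σ (i + 1) - σ i).val = zrep n (σ (i + 1)) - zrep n (σ i) := by
      rw [← ZMod.val_natCast_of_lt (a := zrep n (σ (i + 1)) - zrep n (σ i)) (n := n) (by omega),
        Nat.cast_sub (by omega), hxc, hyc]
    rw [hval]
    omega

theorem zrep_add_one (n : ℕ) [NeZero n] (a : ZMod n) :
    (zrep n (a + 1) : ℤ) = zrep n a + 1 - n * (if a = 0 then 1 else 0) := by
  have hn := NeZero.pos n
  have hlt := ZMod.val_lt a
  have hval : (a + 1).val = (a.val + 1) % n := by
    rw [← ZMod.val_natCast, Nat.cast_add, ZMod.natCast_zmod_val, Nat.cast_one]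
  by_cases ha : a = 0
  · subst ha
    rw [ZMod.val_zero] at hval
    unfold zrep
    rw [hval]
    rcases Nat.lt_or_ge 1 n with h | h
    · simp [Nat.mod_eq_of_lt h]
    · obtain rfl : n = 1 := by omega
      simp
  · have h0 : a.val ≠ 0 := fun h => ha ((ZMod.val_eq_zero a).1 h)
    unfold zrep
    rw [hval]
    rcases Nat.lt_or_ge (a.val + 1) n with h | h
    · simp [Nat.mod_eq_of_lt h, h0, ha]
    · have h1 : a.val + 1 = n := by omega
      rw [h1, Nat.mod_self]
      simp only [if_true, h0, ha, if_false]
      omega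

theorem Tmap_apply (n : ℕ) (σ : Equiv.Perm (ZMod n)) (i : ZMod n) :
    Tmap n σ i = σ (i - 1) + 1 := by
  simp [Tmap, sub_eq_add_neg]

theorem descent_Tmap (n : ℕ) [NeZero n] (σ : Equiv.Perm (ZMod n)) (i : ZMod n) :
    descent n (Tmap n σ) (i + 1) =
      descent n σ i + (if σ (i + 1) = 0 then 1 else 0) - (if σ i = 0 then 1 else 0) := by
  have hn : (n : ℤ) ≠ 0 := by exact_mod_cast NeZero.ne n
  refine mul_left_cancel₀ hn ?_
  rw [mul_descent, mul_sub, mul_add, mul_descent, Tmap_apply, Tmap_apply, add_sub_cancel_right,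
    add_sub_cancel_right, add_sub_add_right_eq_sub, zrep_add_one, zrep_add_one]
  ring

/-- The cyclic major index, as a residue class. -/
def majClass (n : ℕ) [NeZero n] (σ : Equiv.Perm (ZMod n)) : ZMod n :=
  ∑ i : ZMod n, i * (descent n σ i : ZMod n)

/-- The number of cyclic descents of `σ`. -/
def cyclicDescents (n : ℕ) [NeZero n] (σ : Equiv.Perm (ZMod n)) : ℤ :=
  ∑ i : ZMod n, descent n σ i

theorem sum_ite_apply_eq_zero {n : ℕ} [NeZero n] {R : Type*} [Semiring R]
    (σ : Equiv.Perm (ZMod n)) (f : ZMod n → R) :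
    ∑ i : ZMod n, f i * (if σ i = 0 then 1 else 0) = f (σ.symm 0) := by
  simp [← Equiv.eq_symm_apply]

theorem sum_ite_apply_add_one_eq_zero {n : ℕ} [NeZero n] {R : Type*} [Semiring R]
    (σ : Equiv.Perm (ZMod n)) (f : ZMod n → R) :
    ∑ i : ZMod n, f (i + 1) * (if σ (i + 1) = 0 then 1 else 0) = f (σ.symm 0) := by
  rw [← sum_ite_apply_eq_zero σ f]
  exact Equiv.sum_comp (Equiv.addRight (1 : ZMod n)) fun i => f i * (if σ i = 0 then 1 else 0)

theorem cyclicDescents_Tmap (n : ℕ) [NeZero n] (σ : Equiv.Perm (ZMod n)) :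
    cyclicDescents n (Tmap n σ) = cyclicDescents n σ := by
  unfold cyclicDescents
  rw [← Equiv.sum_comp (Equiv.addRight (1 : ZMod n))]
  have h1 := sum_ite_apply_eq_zero (R := ℤ) σ fun _ => 1
  have h2 := sum_ite_apply_add_one_eq_zero (R := ℤ) σ fun _ => 1
  simp only [one_mul] at h1 h2
  simp only [Equiv.coe_addRight, descent_Tmap, Finset.sum_add_distrib, Finset.sum_sub_distrib,
    h1, h2]
  ring

theorem majClass_Tmap (n : ℕ) [NeZero n] (σ : Equiv.Perm (ZMod n)) :
    majClass n (Tmap n σ) = majClass n σ + (cyclicDescents n σ - 1 : ℤ) := by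
  unfold majClass cyclicDescents
  rw [← Equiv.sum_comp (Equiv.addRight (1 : ZMod n))]
  have h1 := sum_ite_apply_eq_zero σ fun i => i + 1
  have h2 := sum_ite_apply_add_one_eq_zero σ fun i => i
  simp only [Equiv.coe_addRight, descent_Tmap]
  push_cast
  simp only [mul_add, mul_sub, Finset.sum_add_distrib, Finset.sum_sub_distrib, add_mul, one_mul] at h1 h2 ⊢
  linear_combination h2 - h1

theorem sum_range_natCast_zmod {n : ℕ} [NeZero n] {M : Type*} [AddCommMonoid M] (f : ZMod n → M) :
    ∑ i ∈ Finset.range n, f i = ∑ a : ZMod n, f a :=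
  Finset.sum_bij' (fun i _ => (i : ZMod n)) (fun a _ => a.val) (by simp)
    (fun a _ => Finset.mem_range.2 (ZMod.val_lt a))
    (fun i hi => ZMod.val_natCast_of_lt (Finset.mem_range.1 hi))
    (fun a _ => ZMod.natCast_zmod_val a) (by simp)

theorem natCast_maj (n : ℕ) [NeZero n] (σ : Equiv.Perm (ZMod n)) :
    (maj n σ : ZMod n) = majClass n σ := by
  unfold majClass maj
  rw [← sum_range_natCast_zmod fun i : ZMod n => i * (descent n σ i : ZMod n), Nat.cast_sum]
  have hsub : Finset.Icc 1 (n - 1) ⊆ Finset.range n := by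
    intro i hi
    have := NeZero.pos n
    simp only [Finset.mem_Icc, Finset.mem_range] at hi ⊢
    omega
  rw [← Finset.sum_subset hsub]
  · refine Finset.sum_congr rfl fun i _ => ?_
    unfold descent
    split_ifs <;> simp
  · intro i hi hi'
    simp only [Finset.mem_Icc, Finset.mem_range] at hi hi'
    obtain rfl : i = 0 := by omega
    simp

theorem mul_cyclicDescents (n : ℕ) [NeZero n] (σ : Equiv.Perm (ZMod n)) :
    (n : ℤ) * cyclicDescents n σ = ∑ i : ZMod n, ((σ (i + 1) - σ i).val : ℤ) := by
  have h := Equiv.sum_comp (Equiv.addRight (1 : ZMod n)) fun i => (zrep n (σ i) : ℤ)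
  simp only [Equiv.coe_addRight] at h
  unfold cyclicDescents
  simp only [Finset.mul_sum, mul_descent, Finset.sum_add_distrib, Finset.sum_sub_distrib, h]
  ring

theorem one_le_val_sub {n : ℕ} (hn : 1 < n) (σ : Equiv.Perm (ZMod n)) (i : ZMod n) :
    1 ≤ (σ (i + 1) - σ i).val := by
  have : Fact (1 < n) := ⟨hn⟩
  refine Nat.one_le_iff_ne_zero.2 fun h => ?_
  have h' := σ.injective (sub_eq_zero.1 ((ZMod.val_eq_zero _).1 h))
  simp at h'

theorem cyclicDescents_pos {n : ℕ} [NeZero n] (hn : 1 < n) (σ : Equiv.Perm (ZMod n)) :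
    0 < cyclicDescents n σ := by
  have h : 0 < (n : ℤ) * cyclicDescents n σ := by
    rw [mul_cyclicDescents]
    exact Finset.sum_pos (fun i _ => by exact_mod_cast one_le_val_sub hn σ i)
      Finset.univ_nonempty
  exact pos_of_mul_pos_right h (by positivity)

theorem cyclicDescents_lt (n : ℕ) [NeZero n] (σ : Equiv.Perm (ZMod n)) :
    cyclicDescents n σ < n := by
  have hn : (0 : ℤ) < n := by exact_mod_cast NeZero.pos n
  refine lt_of_mul_lt_mul_left (a := (n : ℤ)) ?_ hn.le
  rw [mul_cyclicDescents]
  calc ∑ i : ZMod n, ((σ (i + 1) - σ i).val : ℤ) < ∑ _i : ZMod n, (n : ℤ) :=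
        Finset.sum_lt_sum_of_nonempty Finset.univ_nonempty
          fun i _ => by exact_mod_cast ZMod.val_lt _
    _ = n * n := by simp [ZMod.card]

theorem eq_addRight_of_cyclicDescents_eq_one {n : ℕ} [NeZero n] (hn : 1 < n)
    {σ : Equiv.Perm (ZMod n)} (h : cyclicDescents n σ = 1) : σ = Equiv.addRight (σ 0) := by
  have hsum : ∑ _i : ZMod n, (1 : ℤ) = ∑ i : ZMod n, ((σ (i + 1) - σ i).val : ℤ) := by
    rw [← mul_cyclicDescents, h]
    simp [ZMod.card]
  have hval := (Finset.sum_eq_sum_iff_of_le fun i _ => by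
    exact_mod_cast one_le_val_sub hn σ i).1 hsum
  have hstep : ∀ i, σ (i + 1) = σ i + 1 := by
    intro i
    have h1 : (σ (i + 1) - σ i).val = 1 := by exact_mod_cast (hval i (Finset.mem_univ i)).symm
    have h2 := ZMod.natCast_zmod_val (σ (i + 1) - σ i)
    rw [h1, Nat.cast_one] at h2
    linear_combination -h2
  have hnat : ∀ k : ℕ, σ k = k + σ 0 := by
    intro k
    induction k with
    | zero => simp
    | succ k ih =>
      rw [Nat.cast_succ, hstep, ih]
      ring
  ext1 i
  have := hnat i.val
  rwa [ZMod.natCast_zmod_val] at this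

theorem descent_addRight {n : ℕ} [NeZero n] (hn : 1 < n) (c i : ZMod n) :
    descent n (Equiv.addRight c) i = if i = -c then 1 else 0 := by
  have : Fact (1 < n) := ⟨hn⟩
  have hn : (n : ℤ) ≠ 0 := by exact_mod_cast NeZero.ne n
  refine mul_left_cancel₀ hn ?_
  rw [mul_descent]
  simp only [Equiv.coe_addRight]
  rw [show i + 1 + c = i + c + 1 by ring, zrep_add_one, add_sub_cancel_left, ZMod.val_one]
  simp only [eq_neg_iff_add_eq_zero]
  push_cast
  ring

theorem cyclicDescents_addRight {n : ℕ} [NeZero n] (hn : 1 < n) (c : ZMod n) :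
    cyclicDescents n (Equiv.addRight c) = 1 := by
  simp [cyclicDescents, descent_addRight hn]

theorem majClass_addRight {n : ℕ} [NeZero n] (hn : 1 < n) (c : ZMod n) :
    majClass n (Equiv.addRight c) = -c := by
  simp [majClass, descent_addRight hn]

theorem addRight_pow_apply {n : ℕ} (c x : ZMod n) (k : ℕ) :
    ((Equiv.addRight c : Equiv.Perm (ZMod n)) ^ k) x = x + k * c := by
  induction k with
  | zero => simp
  | succ k ih =>
    rw [pow_succ', Equiv.Perm.mul_apply, ih, Equiv.coe_addRight]
    push_cast
    ring

theorem isCycle_addRight {p : ℕ} [Fact p.Prime] {c : ZMod p} (hc : c ≠ 0) :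
    (Equiv.addRight c : Equiv.Perm (ZMod p)).IsCycle := by
  refine ⟨0, by simpa using hc, fun y _ => ⟨((y / c).val : ℤ), ?_⟩⟩
  rw [zpow_natCast, addRight_pow_apply, ZMod.natCast_zmod_val, zero_add, div_mul_cancel₀ y hc]

theorem card_support_addRight {n : ℕ} [NeZero n] [DecidableEq (ZMod n)] {c : ZMod n} (hc : c ≠ 0) :
    (Equiv.addRight c : Equiv.Perm (ZMod n)).support.card = n := by
  have h : (Equiv.addRight c : Equiv.Perm (ZMod n)).support = Finset.univ := by
    ext x
    simpa using hc
  rw [h, Finset.card_univ, ZMod.card]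

theorem Tmap_injective (n : ℕ) : Function.Injective (Tmap n) := fun _ _ h =>
  mul_left_cancel (mul_right_cancel h)

open scoped Classical in
/-- Summing an additive character of `ZMod p` over the major indices of any set of permutations
stable under conjugation by the rotation, only the rotations contribute. -/
theorem sum_addChar_majClass {p : ℕ} [NeZero p] (hp : 1 < p) {K : Type*} [Field K]
    {ψ : AddChar (ZMod p) K} (hψ : Function.Injective ψ)
    (C : Finset (Equiv.Perm (ZMod p))) (hC : ∀ σ ∈ C, Tmap p σ ∈ C) :
    ∑ σ ∈ C, ψ (majClass p σ) =
      ∑ σ ∈ C with cyclicDescents p σ = 1, ψ (majClass p σ) := by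
  set e : Equiv.Perm (ZMod p) → K := fun σ => ψ ((cyclicDescents p σ - 1 : ℤ) : ZMod p) - 1
    with he
  set F : Equiv.Perm (ZMod p) → K := fun σ => ψ (majClass p σ) / e σ with hF
  have himage : C.image (Tmap p) = C :=
    Finset.eq_of_subset_of_card_le (Finset.image_subset_iff.2 hC)
      (Finset.card_image_of_injective C (Tmap_injective p)).ge
  have hshift : ∑ σ ∈ C, F (Tmap p σ) = ∑ σ ∈ C, F σ := by
    conv_rhs => rw [← himage]
    exact (Finset.sum_image (Tmap_injective p).injOn).symm
  have hdiff : ∀ σ, F (Tmap p σ) - F σ =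
      if cyclicDescents p σ = 1 then 0 else ψ (majClass p σ) := by
    intro σ
    have h1 : F (Tmap p σ) - F σ = ψ (majClass p σ) * e σ / e σ := by
      simp only [hF, he, cyclicDescents_Tmap, majClass_Tmap, AddChar.map_add_eq_mul]
      ring
    rw [h1]
    split_ifs with h
    · simp [he, h]
    · refine mul_div_cancel_right₀ _ fun h0 => h ?_
      have h2 := hψ ((sub_eq_zero.1 h0).trans (AddChar.map_zero_eq_one ψ).symm)
      have h3 := Int.eq_zero_of_abs_lt_dvd ((ZMod.intCast_zmod_eq_zero_iff_dvd _ p).1 h2) ?_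
      · omega
      · have := cyclicDescents_pos hp σ
        have := cyclicDescents_lt p σ
        rw [abs_lt]
        omega
  have hzero : ∑ σ ∈ C with ¬cyclicDescents p σ = 1, ψ (majClass p σ) = 0 := by
    rw [← sub_eq_zero.2 hshift, ← Finset.sum_sub_distrib, Finset.sum_filter]
    refine Finset.sum_congr rfl fun σ _ => ?_
    rw [hdiff]
    split_ifs <;> rfl
  rw [← Finset.sum_filter_add_sum_filter_not C (fun σ => cyclicDescents p σ = 1), hzero, add_zero]

open scoped Classical in
/-- for a prime p, `𝔣_{p-1}(q) ≡ -1 (mod [p]_q)` in ℤ[q]. -/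
theorem q_wilson_prime (p : ℕ) [NeZero p] (hp : p.Prime) :
    (∑ i ∈ Finset.range p, (Polynomial.X : Polynomial ℤ) ^ i) ∣
      (∑ σ ∈ Finset.univ.filter
          (fun σ : Equiv.Perm (ZMod p) => σ.IsCycle ∧ σ.support.card = p),
        (Polynomial.X : Polynomial ℤ) ^ maj p σ) + 1 := by
  have : Fact p.Prime := ⟨hp⟩
  obtain ⟨ζ, hζ⟩ : ∃ ζ : ℂ, IsPrimitiveRoot ζ p := ⟨_, Complex.isPrimitiveRoot_exp p hp.ne_zero⟩
  rw [← Polynomial.cyclotomic_prime, Polynomial.cyclotomic_eq_minpoly hζ hp.pos]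
  refine minpoly.isIntegrallyClosed_dvd (hζ.isIntegral hp.pos) ?_
  set ψ := AddChar.zmodChar p hζ.pow_eq_one with hψdef
  have hψ : Function.Injective ψ := by
    intro a b hab
    rw [hψdef, AddChar.zmodChar_apply, AddChar.zmodChar_apply] at hab
    exact ZMod.val_injective p (hζ.pow_inj (ZMod.val_lt a) (ZMod.val_lt b) hab)
  set C := Finset.univ.filter
    (fun σ : Equiv.Perm (ZMod p) => σ.IsCycle ∧ σ.support.card = p) with hCdef
  have hC : ∀ σ ∈ C, Tmap p σ ∈ C := by
    intro σ hσ
    rw [hCdef, Finset.mem_filter] at hσ ⊢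
    exact ⟨Finset.mem_univ _, hσ.2.1.conj, Equiv.Perm.card_support_conj.trans hσ.2.2⟩
  have hrot : (C.filter fun σ => cyclicDescents p σ = 1) =
      (Finset.univ.erase (0 : ZMod p)).image fun c => (Equiv.addRight c : Equiv.Perm (ZMod p)) := by
    ext σ
    simp only [hCdef, Finset.mem_filter, Finset.mem_image, Finset.mem_erase, Finset.mem_univ,
      true_and, and_true]
    constructor
    · rintro ⟨⟨hcyc, -⟩, hd⟩
      have h := eq_addRight_of_cyclicDescents_eq_one hp.one_lt hd
      refine ⟨σ 0, fun h0 => hcyc.ne_one ?_, h.symm⟩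
      rw [h, h0]
      ext
      simp
    · rintro ⟨c, hc, rfl⟩
      exact ⟨⟨isCycle_addRight hc, card_support_addRight hc⟩, cyclicDescents_addRight hp.one_lt c⟩
  have hinj : Function.Injective fun c => (Equiv.addRight c : Equiv.Perm (ZMod p)) := by
    intro c d h
    simpa using Equiv.congr_fun h 0
  have hsum : ∑ a : ZMod p, ψ (-a) = 0 := by
    refine (Equiv.sum_comp (Equiv.neg (ZMod p)) ψ).trans ?_
    refine AddChar.sum_eq_zero_of_ne_one fun h1 => one_ne_zero (α := ZMod p) (hψ ?_)
    simp [h1]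
  have hterm : ∀ σ, ζ ^ maj p σ = ψ (majClass p σ) := by
    intro σ
    rw [← natCast_maj, hψdef, AddChar.zmodChar_apply']
  simp only [map_add, map_sum, map_pow, Polynomial.aeval_X, map_one, hterm]
  rw [sum_addChar_majClass hp.one_lt hψ C hC, hrot, Finset.sum_image hinj.injOn]
  simp only [majClass_addRight hp.one_lt]
  rw [← hsum, ← Finset.sum_erase_add _ _ (Finset.mem_univ (0 : ZMod p))]
  simp
end

section
/- Let n ≥ 2 and let a be a positive integer with gcd(a,n) = 1. Then in ℤ[q], Π_{k=1}^{n−1} [a]_{q^k} ≡ 1 modulo the n-th cyclotomic polynomial Φ_n(q), where [a]_{q^k} := 1 + q^k + q^{2k} + ⋯ + q^{(a−1)k}. -/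
/-- Multiplication by `a` permutes the nonzero residues modulo `n` when `a` is coprime to `n`. -/
theorem prod_Icc_mul_mod_of_coprime {M : Type*} [CommMonoid M] {n a : ℕ} (hn : 0 < n)
    (hg : Nat.Coprime a n) (f : ℕ → M) :
    ∏ k ∈ Finset.Icc 1 (n - 1), f (a * k % n) = ∏ k ∈ Finset.Icc 1 (n - 1), f k := by
  have hmaps : Set.MapsTo (fun k => a * k % n) (Finset.Icc 1 (n - 1) : Finset ℕ)
      (Finset.Icc 1 (n - 1) : Finset ℕ) := by
    intro k hk
    simp only [Finset.coe_Icc, Set.mem_Icc] at hk ⊢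
    have hlt := Nat.mod_lt (a * k) hn
    have hne : a * k % n ≠ 0 := fun h => by
      have := Nat.le_of_dvd (by omega) (hg.symm.dvd_of_dvd_mul_left (Nat.dvd_of_mod_eq_zero h))
      omega
    omega
  have hinj : Set.InjOn (fun k => a * k % n) (Finset.Icc 1 (n - 1) : Finset ℕ) := by
    intro k hk l hl h
    simp only [Finset.coe_Icc, Set.mem_Icc] at hk hl
    have hkl : k ≡ l [MOD n] := Nat.ModEq.cancel_left_of_coprime hg.symm h
    exact hkl.eq_of_lt_of_lt (by omega) (by omega)
  exact Finset.prod_nbij _ hmaps hinj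
    (Finset.surjOn_of_injOn_of_card_le _ hmaps hinj le_rfl) fun _ _ => rfl

/-- The product of the `q`-integers `[a]_{ζ ^ k}` over `0 < k < n` is `1` at a primitive `n`-th root
of unity `ζ`, when `a` is coprime to `n`. -/
theorem IsPrimitiveRoot.prod_geom_sum_eq_one {R : Type*} [CommRing R] [IsDomain R] {ζ : R}
    {n a : ℕ} (hζ : IsPrimitiveRoot ζ n) (hn : 0 < n) (hg : Nat.Coprime a n) :
    ∏ k ∈ Finset.Icc 1 (n - 1), ∑ j ∈ Finset.range a, ζ ^ (j * k) = 1 := by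
  have hne : ∏ k ∈ Finset.Icc 1 (n - 1), (ζ ^ k - 1) ≠ 0 := by
    refine Finset.prod_ne_zero_iff.mpr fun k hk => ?_
    rw [Finset.mem_Icc] at hk
    exact sub_ne_zero.mpr (hζ.pow_ne_one_of_pos_of_lt (by omega) (by omega))
  refine mul_right_cancel₀ hne ?_
  rw [one_mul, ← Finset.prod_mul_distrib,
    ← prod_Icc_mul_mod_of_coprime hn hg fun k => ζ ^ k - 1]
  refine Finset.prod_congr rfl fun k _ => ?_
  simp only [mul_comm _ k, pow_mul ζ k, geom_sum_mul]
  rw [← pow_mul, hζ.eq_orderOf, pow_mod_orderOf]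

/-- `Π_{k=1}^{n-1} [a]_{q^k} ≡ 1 (mod Φ_n(q))` in ℤ[q] when gcd(a, n) = 1. -/
theorem q_fermat_cyclotomic (n : ℕ) (hn : 2 ≤ n) (a : ℕ) (ha : 0 < a)
    (hg : Nat.gcd a n = 1) :
    Polynomial.cyclotomic n ℤ ∣
      (∏ k ∈ Finset.Icc 1 (n - 1),
        ∑ j ∈ Finset.range a, (Polynomial.X : Polynomial ℤ) ^ (j * k)) - 1 := by
  have hpos : 0 < n := by omega
  have hζ := Complex.isPrimitiveRoot_exp n hpos.ne'
  rw [Polynomial.cyclotomic_eq_minpoly hζ hpos]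
  refine minpoly.isIntegrallyClosed_dvd (hζ.isIntegral hpos) ?_
  simp only [map_sub, map_prod, map_sum, map_pow, Polynomial.aeval_X, map_one]
  rw [hζ.prod_geom_sum_eq_one hpos hg, sub_self]
end
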